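/- arXiv:2202.00318 — 2 statements merged into one kernel-verified Lean document; each statement's English description precedes it below -/
import Mathlib

section
/- Let s > 3 and 0 < α ≤ 1. Then lim_{t → ∞} t^{α/2} · (1/2π) ∫_{-π}^{π} E_α(-t^α · l_s(k)) dk = (1/(2π)) · ζ(s-2)^{-1/2} · ∫_0^∞ u^{-1/2} E_α(-u) du, where the last integral converges and ζ is the Riemann zeta function. That is, for s > 3 the maximum of the fundamental solution decays as t^{-α/2}, so the process is subdiffusive for every 0 < α < 1 and diffusive for α = 1. -/
open Real Filter MeasureTheory Set

/-- The Mittag-Leffler function `E_α(x) = ∑_{j=0}^∞ x^j / Γ(α j + 1)`. -/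
noncomputable def mittagLeffler (α x : ℝ) : ℝ :=
  ∑' j : ℕ, x ^ j / Real.Gamma (α * j + 1)

/-- `l_s(k) = 2 ∑_{d=1}^∞ d^{-s} (1 - cos(dk))`. -/
noncomputable def lsFun (s k : ℝ) : ℝ :=
  2 * ∑' d : ℕ+, (d : ℝ) ^ (-s) * (1 - Real.cos (d * k))

/-- Real Riemann zeta function `ζ(x) = ∑_{k=1}^∞ k^{-x}`. -/
noncomputable def zetaReal (x : ℝ) : ℝ := ∑' k : ℕ+, (k : ℝ) ^ (-x)

/-- Complete monotonicity up to order n on (0,∞). -/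
def CMn : ℕ → (ℝ → ℝ) → Prop
  | 0, f => ∀ p, 0 < p → 0 ≤ f p
  | n + 1, f => (∀ p, 0 < p → 0 ≤ f p) ∧
      ∃ g, CMn n g ∧ ∀ p, 0 < p → HasDerivAt f (-g p) p

lemma CMn.nonneg {n : ℕ} {f : ℝ → ℝ} (h : CMn n f) : ∀ p, 0 < p → 0 ≤ f p := by
  cases n with
  | zero => exact h
  | succ n => exact h.1

lemma CMn.down {n : ℕ} : ∀ {f : ℝ → ℝ}, CMn (n + 1) f → CMn n f := by
  induction n with
  | zero => intro f h; exact h.1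
  | succ n ih =>
    rintro f ⟨h0, g, hg, hd⟩
    exact ⟨h0, g, ih hg, hd⟩

lemma CMn.add {n : ℕ} : ∀ {f g : ℝ → ℝ}, CMn n f → CMn n g → CMn n (fun p => f p + g p) := by
  induction n with
  | zero => intro f g hf hg p hp; exact add_nonneg (hf p hp) (hg p hp)
  | succ n ih =>
    rintro f g ⟨h0, f', hf, hd⟩ ⟨h0', g', hg, hd'⟩
    refine ⟨fun p hp => add_nonneg (h0 p hp) (h0' p hp), _, ih hf hg, fun p hp => ?_⟩
    have := (hd p hp).add (hd' p hp)
    exact this.congr_deriv (by ring)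

lemma CMn.mul {n : ℕ} : ∀ {f g : ℝ → ℝ}, CMn n f → CMn n g → CMn n (fun p => f p * g p) := by
  induction n with
  | zero => intro f g hf hg p hp; exact mul_nonneg (hf p hp) (hg p hp)
  | succ n ih =>
    intro f g Hf Hg
    have Hf' := Hf.down
    have Hg' := Hg.down
    obtain ⟨h0, f', hf, hd⟩ := Hf
    obtain ⟨h0', g', hg, hd'⟩ := Hg
    refine ⟨fun p hp => mul_nonneg (h0 p hp) (h0' p hp), _, (ih hf Hg').add (ih Hf' hg),
      fun p hp => ?_⟩
    have := (hd p hp).mul (hd' p hp)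
    exact this.congr_deriv (by ring)

lemma CMn.rpow {n : ℕ} : ∀ {a c : ℝ}, 0 ≤ a → 0 ≤ c → CMn n (fun p => a * p ^ (-c)) := by
  induction n with
  | zero => intro a c ha hc p hp; positivity
  | succ n ih =>
    intro a c ha hc
    refine ⟨fun p hp => by positivity, _, ih (a := a * c) (c := c + 1) (by positivity)
      (by positivity), fun p hp => ?_⟩
    have := (Real.hasDerivAt_rpow_const (x := p) (p := -c) (Or.inl hp.ne')).const_mul a
    refine this.congr_deriv ?_
    rw [show -c - 1 = -(c + 1) by ring]
    ring

lemma CMn.inv {α : ℝ} (hα : 0 < α) (hα1 : α ≤ 1) (n : ℕ) :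
    CMn n (fun p => (1 + p ^ α)⁻¹) := by
  induction n with
  | zero => intro p hp; positivity
  | succ n ih =>
    refine ⟨fun p hp => by positivity, _, (CMn.rpow (a := α) (c := 1 - α) hα.le
      (by linarith)).mul (ih.mul ih), fun p hp => ?_⟩
    have := ((Real.hasDerivAt_rpow_const (x := p) (p := α) (Or.inl hp.ne')).const_add 1).inv
      (by positivity)
    refine this.congr_deriv ?_
    rw [show -(1 - α) = α - 1 by ring]
    field_simp

lemma CMn.anti {n : ℕ} {f : ℝ → ℝ} (h : CMn (n + 1) f) (p : ℝ) (hp : 0 < p) :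
    f (p + 1) ≤ f p := by
  obtain ⟨h0, g, hg, hd⟩ := h
  have : AntitoneOn f (Ioi 0) := by
    apply antitoneOn_of_deriv_nonpos (convex_Ioi 0)
    · intro x hx; exact (hd x hx).continuousAt.continuousWithinAt
    · intro x hx; rw [interior_Ioi] at hx; exact (hd x hx).differentiableAt.differentiableWithinAt
    · intro x hx; rw [interior_Ioi] at hx; rw [(hd x hx).deriv]
      have := hg.nonneg x hx; linarith
  exact this hp (show (0:ℝ) < p + 1 by linarith) (by linarith)

lemma CMn.diff {n : ℕ} : ∀ {f : ℝ → ℝ}, CMn (n + 1) f → CMn n (fun p => f p - f (p + 1)) := by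
  induction n with
  | zero => intro f h p hp; exact sub_nonneg.2 (h.anti p hp)
  | succ n ih =>
    intro f h
    refine ⟨fun p hp => sub_nonneg.2 (h.anti p hp), ?_⟩
    obtain ⟨h0, g, hg, hd⟩ := h
    refine ⟨_, ih hg, fun p hp => ?_⟩
    have := (hd p hp).sub ((hd (p + 1) (by linarith)).comp_add_const p 1)
    exact this.congr_deriv (by ring)

def CM (f : ℝ → ℝ) : Prop := ∀ n, CMn n f

lemma gamma_lower {c R : ℝ} (hc : 1 ≤ c) (hR : 0 < R) : R ^ (c - 1) * rexp (-R) ≤ Real.Gamma c := by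
  rw [Real.Gamma_eq_integral (by linarith)]
  have hi := Real.GammaIntegral_convergent (show 0 < c by linarith)
  have h1 : ∫ x in Ioi R, rexp (-x) * x ^ (c - 1) ≤ ∫ x in Ioi 0, rexp (-x) * x ^ (c - 1) := by
    apply setIntegral_mono_set hi
    · filter_upwards [self_mem_ae_restrict measurableSet_Ioi] with x hx
      have : (0:ℝ) < x := hx
      show 0 ≤ _
      positivity
    · exact (Ioi_subset_Ioi hR.le).eventuallyLE
  refine le_trans ?_ h1
  have h2 : ∫ x in Ioi R, rexp (-x) * R ^ (c - 1) = R ^ (c - 1) * rexp (-R) := by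
    rw [integral_mul_const, integral_exp_neg_Ioi, mul_comm]
  rw [← h2]
  apply setIntegral_mono_on
  · exact (integrableOn_exp_neg_Ioi R).mul_const _
  · exact hi.mono_set (Ioi_subset_Ioi hR.le)
  · exact measurableSet_Ioi
  · intro x hx
    have : R < x := hx
    gcongr

lemma ml_summable_bound {α b : ℝ} (hα : 0 < α) (hb : 1 ≤ b) (X : ℝ) (hX : 0 ≤ X) :
    Summable (fun j : ℕ => ((j:ℝ) + 1) * X ^ j / Real.Gamma (α * j + b)) := by
  set R : ℝ := (2 * X + 1) ^ (1 / α) with hRdef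
  have hR : 0 < R := by positivity
  have hRα : R ^ α = 2 * X + 1 := by
    rw [hRdef, ← rpow_mul (by positivity)]; field_simp; simp
  have hs : Summable (fun j : ℕ => ((j:ℝ) + 1) * (1/2:ℝ) ^ j) := by
    have h1 := summable_pow_mul_geometric_of_norm_lt_one 1 (r := (1/2:ℝ)) (by norm_num)
    have h2 := summable_geometric_of_norm_lt_one (x := (1/2:ℝ)) (by norm_num)
    refine (h1.add h2).congr fun j => ?_
    ring
  refine Summable.of_nonneg_of_le (fun j => ?_) (fun j => ?_) (hs.mul_left (rexp R * R ^ (1 - b)))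
  · have : 0 < Real.Gamma (α * j + b) := Real.Gamma_pos_of_pos (by positivity)
    positivity
  · have hg := gamma_lower (c := α * j + b) (R := R) (by nlinarith [mul_nonneg hα.le (Nat.cast_nonneg (α := ℝ) j)]) hR
    have : R ^ (α * j + b - 1) = (2 * X + 1) ^ j * (R ^ (1 - b))⁻¹ := by
      rw [← rpow_neg hR.le, show α * j + b - 1 = α * j + -(1-b) by ring, rpow_add hR, rpow_mul hR.le,
        hRα, rpow_natCast]
    rw [this] at hg
    have hpos : 0 < (2 * X + 1) ^ j * (R ^ (1 - b))⁻¹ * rexp (-R) := by positivity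
    calc _ ≤ ((j:ℝ) + 1) * X ^ j / ((2 * X + 1) ^ j * (R ^ (1 - b))⁻¹ * rexp (-R)) := by
            gcongr
      _ = rexp R * R ^ (1 - b) * (((j:ℝ) + 1) * (X / (2 * X + 1)) ^ j) := by
            rw [Real.exp_neg, div_pow]; field_simp
      _ ≤ _ := by
            have : X / (2 * X + 1) ≤ 1 / 2 := by
              rw [div_le_div_iff₀ (by positivity) (by positivity)]; linarith
            gcongr

/-- generalized ML series -/
noncomputable def mlg (α b : ℝ) (a : ℕ → ℝ) (x : ℝ) : ℝ :=
  ∑' j : ℕ, a j * x ^ j / Real.Gamma (α * j + b)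

lemma ml_norm_le {α b : ℝ} (hα : 0 < α) (hb : 1 ≤ b) {a : ℕ → ℝ} (ha : ∀ j, |a j| ≤ j + 1)
    {x X : ℝ} (hx : |x| ≤ X) (j : ℕ) :
    ‖a j * x ^ j / Real.Gamma (α * j + b)‖ ≤ ((j:ℝ) + 1) * X ^ j / Real.Gamma (α * j + b) := by
  have : 0 < Real.Gamma (α * j + b) := Real.Gamma_pos_of_pos (by positivity)
  rw [Real.norm_eq_abs, abs_div, abs_mul, abs_pow, abs_of_pos this]
  have := ha j
  gcongr

lemma mlg_summable {α b : ℝ} (hα : 0 < α) (hb : 1 ≤ b) {a : ℕ → ℝ} (ha : ∀ j, |a j| ≤ j + 1)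
    (x : ℝ) : Summable (fun j : ℕ => a j * x ^ j / Real.Gamma (α * j + b)) :=
  Summable.of_norm_bounded (ml_summable_bound hα hb |x| (abs_nonneg x))
    (fun j => ml_norm_le hα hb ha le_rfl j)

lemma mlg_continuous {α b : ℝ} (hα : 0 < α) (hb : 1 ≤ b) {a : ℕ → ℝ} (ha : ∀ j, |a j| ≤ j + 1) :
    Continuous (mlg α b a) := by
  rw [continuous_iff_continuousAt]
  intro x
  have hc : ContinuousOn (mlg α b a) (Icc (-(|x| + 1)) (|x| + 1)) := by
    apply continuousOn_tsum (u := fun j : ℕ => ((j:ℝ) + 1) * (|x| + 1) ^ j / Real.Gamma (α * j + b))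
    · intro j; fun_prop
    · exact ml_summable_bound hα hb _ (by positivity)
    · intro j y hy; exact ml_norm_le hα hb ha (abs_le.2 hy) j
  apply hc.continuousAt
  apply Icc_mem_nhds
  · linarith [neg_abs_le x]
  · linarith [le_abs_self x]

lemma lap_summable {α b p : ℝ} (hα : 0 < α) (hp : 1 < p) :
    Summable (fun j : ℕ => ((j:ℝ) + 1) * p ^ (-(α * j + b))) := by
  have hp0 : 0 < p := by linarith
  have hq : p ^ (-α) < 1 := Real.rpow_lt_one_of_one_lt_of_neg hp (by linarith)
  have hq0 : 0 < p ^ (-α) := by positivity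
  have hn : ‖p ^ (-α)‖ < 1 := by rw [Real.norm_of_nonneg hq0.le]; exact hq
  have h1 := summable_pow_mul_geometric_of_norm_lt_one 1 hn
  have h2 := summable_geometric_of_norm_lt_one hn
  refine ((h1.add h2).mul_left (p ^ (-b))).congr fun j => ?_
  rw [show -(α * j + b) = (-α) * j + (-b) by ring, rpow_add hp0, rpow_mul hp0.le, rpow_natCast]
  ring

noncomputable def phi (α b : ℝ) (a : ℕ → ℝ) (t : ℝ) : ℝ := t ^ (b - 1) * mlg α b a (t ^ α)

lemma phi_continuousOn {α b : ℝ} (hα : 0 < α) (hb : 1 ≤ b) {a : ℕ → ℝ} (ha : ∀ j, |a j| ≤ j + 1) :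
    Continuous (phi α b a) := by
  unfold phi
  exact (Real.continuous_rpow_const (by linarith)).mul
    ((mlg_continuous hα hb ha).comp (Real.continuous_rpow_const hα.le))

lemma phi_eq {α b : ℝ} {a : ℕ → ℝ} {t : ℝ} (ht : 0 < t) :
    phi α b a t = ∑' j : ℕ, a j * t ^ (α * j + b - 1) / Real.Gamma (α * j + b) := by
  unfold phi mlg
  rw [← tsum_mul_left]
  congr 1; ext j
  rw [show α * j + b - 1 = α * j + (b - 1) by ring, rpow_add ht, rpow_mul ht.le, rpow_natCast]
  ring

lemma term_int {c p : ℝ} (hc : 0 < c) (hp : 0 < p) :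
    IntegrableOn (fun t : ℝ => t ^ (c - 1) * rexp (-(p * t))) (Ioi 0) := by
  apply Integrable.of_integral_ne_zero
  rw [integral_rpow_mul_exp_neg_mul_Ioi hc hp]
  have := Real.Gamma_pos_of_pos hc
  positivity

lemma laplace_sum {α b : ℝ} (hα : 0 < α) (hb : 1 ≤ b) {a : ℕ → ℝ} (ha : ∀ j, |a j| ≤ j + 1)
    {p : ℝ} (hp : 1 < p) :
    HasSum (fun j : ℕ => a j * p ^ (-(α * j + b))) (∫ t in Ioi 0, rexp (-(p * t)) * phi α b a t) := by
  have hp0 : 0 < p := by linarith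
  have hG : ∀ j : ℕ, 0 < Real.Gamma (α * j + b) := fun j => Real.Gamma_pos_of_pos (by positivity)
  have hc : ∀ j : ℕ, 0 < α * j + b := fun j => by positivity
  set F : ℕ → ℝ → ℝ := fun j t =>
    (a j / Real.Gamma (α * j + b)) * (t ^ (α * j + b - 1) * rexp (-(p * t))) with hF
  have hFi : ∀ j, Integrable (F j) (volume.restrict (Ioi 0)) := fun j =>
    (term_int (hc j) hp0).const_mul _
  have hint : ∀ j : ℕ, ∫ t in Ioi (0:ℝ), t ^ (α * j + b - 1) * rexp (-(p * t)) =
      p ^ (-(α * j + b)) * Real.Gamma (α * j + b) := fun j => by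
    rw [integral_rpow_mul_exp_neg_mul_Ioi (hc j) hp0, one_div, inv_rpow hp0.le, rpow_neg hp0.le]
  have hn : ∀ j, ∫ t in Ioi (0:ℝ), ‖F j t‖ = |a j| * p ^ (-(α * j + b)) := fun j => by
    have : ∫ t in Ioi (0:ℝ), ‖F j t‖ = ∫ t in Ioi (0:ℝ), (|a j| / Real.Gamma (α * j + b)) *
        (t ^ (α * j + b - 1) * rexp (-(p * t))) := by
      apply setIntegral_congr_fun measurableSet_Ioi
      intro t ht
      have ht : 0 < t := ht
      simp only [hF, norm_mul, norm_div, Real.norm_eq_abs, abs_of_pos (hG j), abs_of_pos (exp_pos _),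
        abs_of_pos (rpow_pos_of_pos ht _)]
    rw [this, integral_const_mul, hint]
    have := (hG j).ne'
    field_simp
  have key := hasSum_integral_of_summable_integral_norm hFi (by
    simp_rw [hn]
    refine Summable.of_nonneg_of_le (fun j => by positivity) (fun j => ?_) (lap_summable hα hp (b := b))
    have := ha j
    gcongr)
  have e1 : (fun j : ℕ => a j * p ^ (-(α * j + b))) = fun j => ∫ t in Ioi (0:ℝ), F j t := by
    ext j
    simp only [hF]
    rw [integral_const_mul, hint]
    have := (hG j).ne'
    field_simp
  have e2 : ∫ t in Ioi (0:ℝ), rexp (-(p * t)) * phi α b a t = ∫ t in Ioi (0:ℝ), ∑' j, F j t := by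
    apply setIntegral_congr_fun measurableSet_Ioi
    intro t ht
    have ht : 0 < t := ht
    simp only [hF]
    rw [phi_eq ht, ← tsum_mul_left]
    congr 1; ext j
    ring
  rw [e1, e2]
  exact key

lemma laplace_int {α b : ℝ} (hα : 0 < α) (hb : 1 ≤ b) {a : ℕ → ℝ} (ha : ∀ j, |a j| ≤ j + 1)
    {p : ℝ} (hp : 1 < p) :
    IntegrableOn (fun t => rexp (-(p * t)) * phi α b a t) (Ioi 0) := by
  have hp0 : 0 < p := by linarith
  have hG : ∀ j : ℕ, 0 < Real.Gamma (α * j + b) := fun j => Real.Gamma_pos_of_pos (by positivity)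
  have h1 : ∀ j : ℕ, |(j:ℝ) + 1| ≤ j + 1 := fun j => by rw [abs_of_nonneg (by positivity)]
  have hs := laplace_sum hα hb (a := fun j => (j:ℝ) + 1) h1 hp
  have hi : IntegrableOn (fun t => rexp (-(p * t)) * phi α b (fun j => (j:ℝ) + 1) t) (Ioi 0) := by
    apply Integrable.of_integral_ne_zero
    rw [← hs.tsum_eq]
    refine (hs.summable.tsum_pos (fun j => by positivity) 0 ?_).ne'
    positivity
  refine Integrable.mono' hi ?_ ?_
  · have := phi_continuousOn hα hb ha
    exact (by fun_prop : Continuous _).aestronglyMeasurable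
  · filter_upwards [self_mem_ae_restrict measurableSet_Ioi] with t ht
    have ht : 0 < t := ht
    rw [norm_mul, Real.norm_of_nonneg (exp_pos _).le]
    gcongr
    unfold phi
    rw [norm_mul, Real.norm_of_nonneg (rpow_pos_of_pos ht _).le]
    gcongr
    unfold mlg
    refine tsum_of_norm_bounded (mlg_summable hα hb h1 _).hasSum fun j => ?_
    exact ml_norm_le hα hb ha (abs_of_pos (rpow_pos_of_pos ht _)).le j

lemma diff_int {α b : ℝ} (hα : 0 < α) (hb : 1 ≤ b) {a : ℕ → ℝ} (ha : ∀ j, |a j| ≤ j + 1)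
    (k : ℕ) : ∀ {p : ℝ}, 1 < p →
    IntegrableOn (fun t => rexp (-(p * t)) * (1 - rexp (-t)) ^ k * phi α b a t) (Ioi 0) := by
  induction k with
  | zero => intro p hp; simpa using laplace_int hα hb ha hp
  | succ k ih =>
    intro p hp
    refine ((ih hp).sub (ih (p := p + 1) (by linarith))).congr ?_
    refine Filter.Eventually.of_forall fun t => ?_
    simp only [Pi.sub_apply]
    rw [show -((p + 1) * t) = -(p * t) + -t by ring, Real.exp_add]
    ring

lemma diff_nonneg {α b : ℝ} (hα : 0 < α) (hb : 1 ≤ b) {a : ℕ → ℝ} (ha : ∀ j, |a j| ≤ j + 1)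
    {H : ℝ → ℝ} (hH : CM H)
    (hHs : ∀ p, 1 < p → HasSum (fun j : ℕ => a j * p ^ (-(α * j + b))) (H p)) (k : ℕ)
    {p : ℝ} (hp : 1 < p) :
    0 ≤ ∫ t in Ioi (0:ℝ), rexp (-(p * t)) * (1 - rexp (-t)) ^ k * phi α b a t := by
  have key : ∀ k : ℕ, ∃ G, CM G ∧ ∀ p, 1 < p →
      ∫ t in Ioi (0:ℝ), rexp (-(p * t)) * (1 - rexp (-t)) ^ k * phi α b a t = G p := by
    intro k
    induction k with
    | zero =>
      refine ⟨H, hH, fun p hp => ?_⟩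
      simpa using (laplace_sum hα hb ha hp).unique (hHs p hp)
    | succ k ih =>
      obtain ⟨G, hG, hGp⟩ := ih
      refine ⟨_, fun n => (hG (n + 1)).diff, fun p hp => ?_⟩
      rw [← hGp p hp, ← hGp (p + 1) (by linarith), ← integral_sub (diff_int hα hb ha k hp)
        (diff_int hα hb ha k (by linarith))]
      congr 1; ext t
      rw [show -((p + 1) * t) = -(p * t) + -t by ring, Real.exp_add]
      ring
  obtain ⟨G, hG, hGp⟩ := key k
  rw [hGp p hp]
  exact (hG 0).nonneg p (by linarith)

noncomputable def expI (t : ℝ) : unitInterval := ⟨rexp (-|t|), (exp_pos _).le, by simp⟩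

lemma expI_continuous : Continuous expI := by unfold expI; fun_prop

lemma test_nonneg {α b : ℝ} (hα : 0 < α) (hb : 1 ≤ b) {a : ℕ → ℝ} (ha : ∀ j, |a j| ≤ j + 1)
    {H : ℝ → ℝ} (hH : CM H)
    (hHs : ∀ p, 1 < p → HasSum (fun j : ℕ => a j * p ^ (-(α * j + b))) (H p))
    (q : C(unitInterval, ℝ)) (hq : ∀ x, 0 ≤ q x) :
    0 ≤ ∫ t in Ioi (0:ℝ), q (expI t) * (rexp (-(2 * t)) * phi α b a t) := by
  have h2 := laplace_int hα hb ha (p := 2) (by norm_num)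
  have hqi : ∀ q : C(unitInterval, ℝ), IntegrableOn
      (fun t => q (expI t) * (rexp (-(2 * t)) * phi α b a t)) (Ioi 0) := fun q => by
    refine h2.bdd_mul (c := ‖q‖) ?_ ?_
    · exact (q.continuous.comp expI_continuous).aestronglyMeasurable
    · exact Filter.Eventually.of_forall fun t => q.norm_coe_le_norm _
  have hb1 : ∀ n, 0 ≤ ∫ t in Ioi (0:ℝ), (bernsteinApproximation n q) (expI t) *
      (rexp (-(2 * t)) * phi α b a t) := by
    intro n
    simp_rw [bernsteinApproximation.apply, smul_eq_mul, Finset.sum_mul]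
    rw [integral_finsetSum]
    · refine Finset.sum_nonneg fun k _ => ?_
      have h0 := diff_nonneg hα hb ha hH hHs (n - k) (p := 2 + k) (by
        have : (0:ℝ) ≤ (k:ℕ) := Nat.cast_nonneg _
        linarith)
      have : ∫ t in Ioi (0:ℝ), bernstein n k (expI t) * q (bernstein.z k) *
          (rexp (-(2 * t)) * phi α b a t) = ∫ t in Ioi (0:ℝ), (n.choose k * q (bernstein.z k)) *
          (rexp (-((2 + (k:ℕ)) * t)) * (1 - rexp (-t)) ^ (n - (k:ℕ)) * phi α b a t) := by
        apply setIntegral_congr_fun measurableSet_Ioi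
        intro t ht
        have ht : 0 < t := ht
        simp only [bernstein_apply, expI, abs_of_pos ht]
        rw [show -((2 + (k:ℕ)) * t) = -(2 * t) + (k:ℕ) * (-t) by ring, Real.exp_add,
          Real.exp_nat_mul]
        ring
      rw [this, integral_const_mul]
      have := hq (bernstein.z k)
      positivity
    · intro k _
      have := (hqi (bernstein n k)).mul_const (q (bernstein.z k))
      refine this.congr (Filter.Eventually.of_forall fun t => ?_)
      simp only; ring
  have hlim : Tendsto (fun n => ∫ t in Ioi (0:ℝ), (bernsteinApproximation n q) (expI t) *
      (rexp (-(2 * t)) * phi α b a t)) atTop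
      (nhds (∫ t in Ioi (0:ℝ), q (expI t) * (rexp (-(2 * t)) * phi α b a t))) := by
    have hT := bernsteinApproximation_uniform q
    refine tendsto_integral_filter_of_dominated_convergence
      (fun t => (‖q‖ + 1) * ‖rexp (-(2 * t)) * phi α b a t‖) ?_ ?_ ?_ ?_
    · exact Filter.Eventually.of_forall fun n => (hqi _).aestronglyMeasurable
    · have := hT.norm.eventually (gt_mem_nhds (show ‖q‖ < ‖q‖ + 1 by linarith))
      filter_upwards [this] with n hn
      refine Filter.Eventually.of_forall fun t => ?_
      rw [norm_mul]
      gcongr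
      exact (ContinuousMap.norm_coe_le_norm _ _).trans hn.le
    · exact h2.norm.const_mul _
    · refine Filter.Eventually.of_forall fun t => ?_
      exact (((continuous_eval_const (expI t)).tendsto q).comp hT).mul_const _
  exact ge_of_tendsto' hlim hb1

lemma phi_nonneg {α b : ℝ} (hα : 0 < α) (hb : 1 ≤ b) {a : ℕ → ℝ} (ha : ∀ j, |a j| ≤ j + 1)
    {H : ℝ → ℝ} (hH : CM H)
    (hHs : ∀ p, 1 < p → HasSum (fun j : ℕ => a j * p ^ (-(α * j + b))) (H p))
    {t₀ : ℝ} (ht₀ : 0 < t₀) : 0 ≤ phi α b a t₀ := by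
  by_contra! hneg
  have hc := phi_continuousOn hα hb ha
  -- work with G y = phi (-log y)
  set y₀ := rexp (-t₀) with hy₀
  have hG : ContinuousAt (fun y => phi α b a (-Real.log y)) y₀ :=
    hc.continuousAt.comp (Real.continuousAt_log (exp_pos _).ne').neg
  have hev : ∀ᶠ y in nhds y₀, phi α b a (-Real.log y) < 0 := by
    apply hG.eventually (gt_mem_nhds _)
    simpa [hy₀] using hneg
  obtain ⟨δ, hδ, hδ'⟩ := Metric.eventually_nhds_iff.1 hev
  let q : C(unitInterval, ℝ) := ⟨fun y => max 0 (δ - |(y:ℝ) - y₀|), by fun_prop⟩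
  have h0 := test_nonneg hα hb ha hH hHs q (fun y => le_max_left _ _)
  have hle : ∀ t, 0 < t → q (expI t) * (rexp (-(2 * t)) * phi α b a t) ≤ 0 := by
    intro t ht
    by_cases h : |rexp (-t) - y₀| < δ
    · have := hδ' (y := rexp (-t)) (by simpa [Real.dist_eq] using h)
      rw [Real.log_exp, neg_neg] at this
      exact mul_nonpos_of_nonneg_of_nonpos (le_max_left _ _)
        (mul_nonpos_of_nonneg_of_nonpos (exp_pos _).le this.le)
    · have : q (expI t) = 0 := by
        simp only [q, expI, ContinuousMap.coe_mk, abs_of_pos ht]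
        exact max_eq_left (by linarith)
      rw [this, zero_mul]
  have hcont : Continuous (fun t => q (expI t) * (rexp (-(2 * t)) * phi α b a t)) :=
    (q.continuous.comp expI_continuous).mul (by fun_prop)
  have h2 := laplace_int hα hb ha (p := 2) (by norm_num)
  have hqi : IntegrableOn
      (fun t => q (expI t) * (rexp (-(2 * t)) * phi α b a t)) (Ioi 0) := by
    refine h2.bdd_mul (c := ‖q‖) ?_ ?_
    · exact (q.continuous.comp expI_continuous).aestronglyMeasurable
    · exact Filter.Eventually.of_forall fun t => q.norm_coe_le_norm _
  have hpos : 0 < ∫ t in Ioi (0:ℝ), -(q (expI t) * (rexp (-(2 * t)) * phi α b a t)) := by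
    rw [setIntegral_pos_iff_support_of_nonneg_ae]
    · have hopen : IsOpen (Function.support (fun t => -(q (expI t) *
          (rexp (-(2 * t)) * phi α b a t))) ∩ Ioi 0) :=
        (hcont.neg.isOpen_support).inter isOpen_Ioi
      refine hopen.measure_pos _ ⟨t₀, ?_, ht₀⟩
      have : q (expI t₀) = δ := by
        simp only [q, expI, ContinuousMap.coe_mk, abs_of_pos ht₀]
        simp [hy₀, hδ.le]
      simp only [Function.mem_support, this]
      have := exp_pos (-(2 * t₀))
      simp [hδ.ne', hneg.ne]
    · filter_upwards [self_mem_ae_restrict measurableSet_Ioi] with t ht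
      simpa using hle t ht
    · exact hqi.neg
  rw [integral_neg] at hpos
  linarith

def alt (j : ℕ) : ℝ := (-1) ^ j
def altj (j : ℕ) : ℝ := (-1) ^ j * (j + 1)

lemma alt_le (j : ℕ) : |alt j| ≤ j + 1 := by simp [alt, abs_pow]
lemma altj_le (j : ℕ) : |altj j| ≤ j + 1 := by
  rw [altj, abs_mul, abs_pow, abs_neg, abs_one, one_pow, one_mul, abs_of_nonneg (by positivity)]

lemma mlg_nonneg_of {α b : ℝ} (hα : 0 < α) (hb : 1 ≤ b) {a : ℕ → ℝ} (ha : ∀ j, |a j| ≤ j + 1)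
    {H : ℝ → ℝ} (hH : CM H)
    (hHs : ∀ p, 1 < p → HasSum (fun j : ℕ => a j * p ^ (-(α * j + b))) (H p))
    {x : ℝ} (hx : 0 < x) : 0 ≤ mlg α b a x := by
  have ht : 0 < x ^ (1 / α) := by positivity
  have h := phi_nonneg hα hb ha hH hHs ht
  unfold phi at h
  rw [← rpow_mul hx.le (1 / α) α, one_div_mul_cancel hα.ne', rpow_one] at h
  exact nonneg_of_mul_nonneg_right h (by positivity)

lemma alt_nonneg {α b : ℝ} (hα : 0 < α) (hα1 : α ≤ 1) (hb : 1 ≤ b) {x : ℝ} (hx : 0 < x) :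
    0 ≤ mlg α b alt x := by
  refine mlg_nonneg_of hα hb alt_le (H := fun p => (1 * p ^ (-(b - α))) * (1 + p ^ α)⁻¹)
    (fun n => (CMn.rpow zero_le_one (by linarith)).mul (CMn.inv hα hα1 n)) ?_ hx
  intro p hp
  have hp0 : 0 < p := by linarith
  have hq : p ^ (-α) < 1 := Real.rpow_lt_one_of_one_lt_of_neg hp (by linarith)
  have hq0 : 0 < p ^ (-α) := by positivity
  have hn : ‖-p ^ (-α)‖ < 1 := by rw [norm_neg, Real.norm_of_nonneg hq0.le]; exact hq
  have h := (hasSum_geometric_of_norm_lt_one hn).mul_left (p ^ (-b))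
  have e1 : (fun j : ℕ => alt j * p ^ (-(α * j + b))) = fun j => p ^ (-b) * (-p ^ (-α)) ^ j := by
    ext j
    rw [show -(α * j + b) = (-α) * j + (-b) by ring, rpow_add hp0, rpow_mul hp0.le, rpow_natCast,
      neg_pow (p ^ (-α)), alt]
    ring
  have e2 : (1 * p ^ (-(b - α))) * (1 + p ^ α)⁻¹ = p ^ (-b) * (1 - -p ^ (-α))⁻¹ := by
    rw [show -(b - α) = -b + α by ring, rpow_add hp0, rpow_neg hp0.le α]
    have h3 : 1 + p ^ α ≠ 0 := by positivity
    have h5 : 1 + (p ^ α)⁻¹ ≠ 0 := by positivity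
    rw [sub_neg_eq_add]
    field_simp
    ring
  rw [e1, e2]
  exact h

lemma altj_nonneg {α : ℝ} (hα : 0 < α) (hα1 : α ≤ 1) {x : ℝ} (hx : 0 < x) :
    0 ≤ mlg α (α + 2) altj x := by
  refine mlg_nonneg_of hα (by linarith) altj_le
    (H := fun p => (1 * p ^ (-(2 - α))) * ((1 + p ^ α)⁻¹ * (1 + p ^ α)⁻¹))
    (fun n => (CMn.rpow zero_le_one (by linarith)).mul
      ((CMn.inv hα hα1 n).mul (CMn.inv hα hα1 n))) ?_ hx
  intro p hp
  have hp0 : 0 < p := by linarith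
  have hq : p ^ (-α) < 1 := Real.rpow_lt_one_of_one_lt_of_neg hp (by linarith)
  have hq0 : 0 < p ^ (-α) := by positivity
  have hn : ‖-p ^ (-α)‖ < 1 := by rw [norm_neg, Real.norm_of_nonneg hq0.le]; exact hq
  have h := ((hasSum_coe_mul_geometric_of_norm_lt_one hn).add
    (hasSum_geometric_of_norm_lt_one hn)).mul_left (p ^ (-(α + 2)))
  have e1 : (fun j : ℕ => altj j * p ^ (-(α * j + (α + 2)))) = fun j : ℕ => p ^ (-(α + 2)) *
      (j * (-p ^ (-α)) ^ j + (-p ^ (-α)) ^ j) := by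
    ext j
    rw [show -(α * j + (α + 2)) = (-α) * j + (-(α + 2)) by ring, rpow_add hp0, rpow_mul hp0.le,
      rpow_natCast, neg_pow (p ^ (-α)), altj]
    ring
  have e2 : (1 * p ^ (-(2 - α))) * ((1 + p ^ α)⁻¹ * (1 + p ^ α)⁻¹) =
      p ^ (-(α + 2)) * (-p ^ (-α) / (1 - -p ^ (-α)) ^ 2 + (1 - -p ^ (-α))⁻¹) := by
    rw [show -(2 - α) = -(α + 2) + (α + α) by ring, rpow_add hp0, rpow_add hp0 α α,
      rpow_neg hp0.le α]
    have : 0 < p ^ α := by positivity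
    have h3 : p ^ α + 1 ≠ 0 := by positivity
    have h4 : 1 - -(p ^ α)⁻¹ ≠ 0 := by rw [sub_neg_eq_add]; positivity
    field_simp
    ring_nf
    field_simp
    try ring
  rw [e1, e2]
  exact h

lemma mlg_rec {α b : ℝ} (hα : 0 < α) (hb : 1 ≤ b) (x : ℝ) :
    mlg α b alt x = 1 / Real.Gamma b - x * mlg α (α + b) alt x := by
  unfold mlg
  rw [(mlg_summable hα hb alt_le x).tsum_eq_zero_add, ← tsum_mul_left, sub_eq_add_neg, ← tsum_neg]
  congr 1
  · simp [alt]
  · congr 1; ext j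
    rw [show α * ((j + 1 : ℕ) : ℝ) + b = α * j + (α + b) by push_cast; ring]
    simp only [alt, pow_succ]
    ring

lemma mlg_diff {α : ℝ} (hα : 0 < α) (x : ℝ) :
    mlg α 2 alt x - mlg α 1 alt x = α * x * mlg α (α + 2) altj x := by
  have s2 := mlg_summable hα (b := 2) (by norm_num) alt_le x
  have s1 := mlg_summable hα (b := 1) (by norm_num) alt_le x
  unfold mlg
  rw [← s2.tsum_sub s1, (s2.sub s1).tsum_eq_zero_add, ← tsum_mul_left]
  simp only [Nat.cast_zero, mul_zero, zero_add, Real.Gamma_one, Real.Gamma_two, sub_self]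
  congr 1; ext j
  have h0 : 0 < α * ((j + 1 : ℕ) : ℝ) + 1 := by positivity
  have hG := Real.Gamma_pos_of_pos h0
  have hr := Real.Gamma_add_one h0.ne'
  rw [show α * ((j + 1 : ℕ) : ℝ) + 2 = α * ((j + 1 : ℕ) : ℝ) + 1 + 1 by ring,
    show α * (j : ℝ) + (α + 2) = α * ((j + 1 : ℕ) : ℝ) + 1 + 1 by push_cast; ring, hr]
  field_simp
  simp only [alt, altj, pow_succ]
  push_cast
  ring

lemma ml_eq (α x : ℝ) : mittagLeffler α (-x) = mlg α 1 alt x := by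
  unfold mittagLeffler mlg
  congr 1; ext j
  rw [neg_pow, alt]

lemma ml_neg_continuous {α : ℝ} (hα : 0 < α) : Continuous (fun x => mittagLeffler α (-x)) := by
  simp_rw [ml_eq]
  exact mlg_continuous hα le_rfl alt_le

lemma ml_bound {α : ℝ} (hα : 0 < α) (hα1 : α ≤ 1) : ∃ C : ℝ, 0 < C ∧ ∀ x : ℝ, 0 ≤ x →
    ‖mittagLeffler α (-x)‖ ≤ C * (1 + x)⁻¹ := by
  have hG : 0 < Real.Gamma (2 - α) := Real.Gamma_pos_of_pos (by linarith)
  refine ⟨1 + 1 / Real.Gamma (2 - α), by positivity, fun x hx => ?_⟩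
  rw [ml_eq]
  have hG' : 0 < 1 / Real.Gamma (2 - α) := by positivity
  rcases hx.eq_or_lt with rfl | hx
  · have : mlg α 1 alt 0 = 1 := by
      have := mlg_rec hα (b := 1) le_rfl 0
      simpa using this
    rw [this]; simp; positivity
  · have h1 := alt_nonneg hα hα1 (b := 1) le_rfl hx
    have h2 := alt_nonneg hα hα1 (b := α + 1) (by linarith) hx
    have h3 := alt_nonneg hα hα1 (b := 2 - α) (by linarith) hx
    have h4 := altj_nonneg hα hα1 hx
    have r1 := mlg_rec hα (b := 1) le_rfl x
    have r2 := mlg_rec hα (b := 2 - α) (by linarith) x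
    have r3 := mlg_diff hα x
    rw [show α + (2 - α) = 2 by ring] at r2
    rw [Real.Gamma_one] at r1
    have q1 : mlg α 1 alt x ≤ 1 := by nlinarith [mul_nonneg hx.le h2]
    have q2 : mlg α 1 alt x ≤ mlg α 2 alt x := by
      nlinarith [mul_nonneg (mul_nonneg hα.le hx.le) h4]
    have q3 : x * mlg α 1 alt x ≤ 1 / Real.Gamma (2 - α) := by
      nlinarith [mul_le_mul_of_nonneg_left q2 hx.le]
    rw [Real.norm_of_nonneg h1, ← div_eq_mul_inv, le_div_iff₀ (by positivity)]
    linarith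

lemma pnat_summable {x : ℝ} (hx : 1 < x) : Summable (fun d : ℕ+ => (d : ℝ) ^ (-x)) :=
  (Real.summable_nat_rpow.2 (by linarith : -x < -1)).comp_injective PNat.coe_injective

lemma ls_term_bound (s k : ℝ) (d : ℕ+) :
    ‖(d : ℝ) ^ (-s) * (1 - Real.cos (d * k))‖ ≤ (d : ℝ) ^ (-s) * 2 := by
  rw [norm_mul, Real.norm_of_nonneg (by positivity : (0:ℝ) ≤ (d : ℝ) ^ (-s))]
  gcongr
  rw [Real.norm_eq_abs, abs_le]
  constructor <;> linarith [Real.cos_le_one (d * k), Real.neg_one_le_cos (d * k)]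

lemma ls_summable {s : ℝ} (hs : 3 < s) (k : ℝ) :
    Summable (fun d : ℕ+ => (d : ℝ) ^ (-s) * (1 - Real.cos (d * k))) :=
  Summable.of_norm_bounded ((pnat_summable (by linarith : 1 < s)).mul_right 2) (ls_term_bound s k)

lemma ls_continuous {s : ℝ} (hs : 3 < s) : Continuous (lsFun s) := by
  unfold lsFun
  refine continuous_const.mul (continuous_tsum (fun d => ?_)
    ((pnat_summable (by linarith : 1 < s)).mul_right 2) (fun d k => ls_term_bound s k d))
  fun_prop

lemma ls_lower {s : ℝ} (hs : 3 < s) {k : ℝ} (hk : |k| ≤ π) : 4 / π ^ 2 * k ^ 2 ≤ lsFun s k := by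
  have h1 := (ls_summable hs k).le_tsum 1 (fun d _ => by
    have : 0 ≤ 1 - Real.cos (d * k) := by linarith [Real.cos_le_one (d * k)]
    positivity)
  simp only [PNat.one_coe, Nat.cast_one, one_rpow, one_mul] at h1
  have h2 := Real.cos_le_one_sub_mul_cos_sq hk
  unfold lsFun
  have : 4 / π ^ 2 * k ^ 2 = 2 * (2 / π ^ 2 * k ^ 2) := by ring
  linarith

lemma cos_lim (c : ℝ) : Tendsto (fun T : ℝ => 2 * (T ^ 2 * (1 - Real.cos (c / T)))) atTop
    (nhds (c ^ 2)) := by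
  -- 2 (1 - cos y) = 4 sin² (y/2)
  have e : ∀ᶠ T : ℝ in atTop, (c * Real.sinc (c / 2 * T⁻¹)) ^ 2 =
      2 * (T ^ 2 * (1 - Real.cos (c / T))) := by
    filter_upwards [eventually_gt_atTop 0] with T hT
    have h2 : 1 - Real.cos (c / T) = 2 * Real.sin (c / 2 * T⁻¹) ^ 2 := by
      rw [Real.sin_sq_eq_half_sub, show 2 * (c / 2 * T⁻¹) = c / T by field_simp]; ring
    rw [h2]
    by_cases hc : c = 0
    · simp [hc]
    · rw [Real.sinc_of_ne_zero (by positivity)]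
      field_simp
  refine Tendsto.congr' e ?_
  have : Tendsto (fun T : ℝ => (c * Real.sinc (c / 2 * T⁻¹)) ^ 2) atTop
      (nhds ((c * Real.sinc (c / 2 * 0)) ^ 2)) :=
    (((Real.continuous_sinc.tendsto _).comp (tendsto_inv_atTop_zero.const_mul _)).const_mul c).pow 2
  simpa using this

lemma ls_lim {s : ℝ} (hs : 3 < s) (w : ℝ) :
    Tendsto (fun T : ℝ => T ^ 2 * lsFun s (w / T)) atTop (nhds (zetaReal (s - 2) * w ^ 2)) := by
  have e : ∀ T : ℝ, T ^ 2 * lsFun s (w / T) =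
      ∑' d : ℕ+, (d : ℝ) ^ (-s) * (2 * (T ^ 2 * (1 - Real.cos (d * w / T)))) := by
    intro T
    unfold lsFun
    rw [← tsum_mul_left, ← tsum_mul_left]
    congr 1; ext d
    rw [mul_div_assoc]; ring
  have e2 : ∀ d : ℕ+, (d : ℝ) ^ (-s) * (d * w) ^ 2 = (d : ℝ) ^ (-(s - 2)) * w ^ 2 := by
    intro d
    have hd : (0:ℝ) < d := by exact_mod_cast d.pos
    rw [show -(s - 2) = -s + (2:ℕ) by push_cast; ring, rpow_add hd, rpow_natCast]; ring
  simp_rw [e]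
  unfold zetaReal
  rw [← tsum_mul_right]
  simp_rw [← e2]
  refine tendsto_tsum_of_dominated_convergence
    (bound := fun d : ℕ+ => (d : ℝ) ^ (-s) * (d * w) ^ 2) ?_ ?_ ?_
  · simp_rw [e2]
    exact (pnat_summable (by linarith)).mul_right _
  · intro d
    exact (cos_lim _).const_mul _
  · filter_upwards [eventually_gt_atTop 0] with T hT d
    have h1 := Real.one_sub_sq_div_two_le_cos (x := d * w / T)
    have h0 : 0 ≤ 1 - Real.cos (d * w / T) := by linarith [Real.cos_le_one (d * w / T)]
    rw [Real.norm_of_nonneg (by positivity)]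
    gcongr
    calc 2 * (T ^ 2 * (1 - Real.cos (d * w / T))) ≤ 2 * (T ^ 2 * ((d * w / T) ^ 2 / 2)) := by
          gcongr; linarith
      _ = _ := by field_simp

lemma zeta_pos {s : ℝ} (hs : 3 < s) : 0 < zetaReal (s - 2) := by
  unfold zetaReal
  refine (pnat_summable (by linarith)).tsum_pos (fun d => by positivity) 1 ?_
  simp

lemma ml_sq_integrable {α : ℝ} (hα : 0 < α) (hα1 : α ≤ 1) :
    Integrable (fun x : ℝ => mittagLeffler α (-(x ^ 2))) := by
  obtain ⟨C, hC, hb⟩ := ml_bound hα hα1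
  refine Integrable.mono' (integrable_inv_one_add_sq.const_mul C) ?_ ?_
  · exact ((ml_neg_continuous hα).comp (continuous_pow 2)).aestronglyMeasurable
  · exact Filter.Eventually.of_forall fun x => hb _ (sq_nonneg x)

lemma subst_aux (α : ℝ) {x : ℝ} (hx : 0 < x) :
    (2 * x ^ ((2:ℝ) - 1)) • ((x ^ (2:ℝ)) ^ (-(1:ℝ)/2) * mittagLeffler α (-(x ^ (2:ℝ)))) =
      2 * mittagLeffler α (-(x ^ 2)) := by
  rw [← rpow_mul hx.le, show (2:ℝ) * (-1 / 2) = -1 by norm_num, show (2:ℝ) - 1 = 1 by norm_num,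
    rpow_one, rpow_neg_one, rpow_two, smul_eq_mul]
  field_simp

lemma part1 {α : ℝ} (hα : 0 < α) (hα1 : α ≤ 1) :
    IntegrableOn (fun u : ℝ => u ^ (-(1:ℝ)/2) * mittagLeffler α (-u)) (Ioi 0) := by
  rw [← integrableOn_Ioi_comp_rpow_iff _ (two_ne_zero : (2:ℝ) ≠ 0)]
  have h : IntegrableOn (fun x : ℝ => 2 * mittagLeffler α (-(x ^ 2))) (Ioi 0) :=
    ((ml_sq_integrable hα hα1).const_mul 2).integrableOn
  refine h.congr_fun ?_ measurableSet_Ioi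
  intro x hx
  simp only [abs_two]
  exact (subst_aux α hx).symm

lemma part2 {α z : ℝ} (hz : 0 < z) :
    ∫ w : ℝ, mittagLeffler α (-(z * w ^ 2)) =
      z ^ (-(1:ℝ)/2) * ∫ u in Ioi (0:ℝ), u ^ (-(1:ℝ)/2) * mittagLeffler α (-u) := by
  have h1 : ∫ u in Ioi (0:ℝ), u ^ (-(1:ℝ)/2) * mittagLeffler α (-u) =
      2 * ∫ x in Ioi (0:ℝ), mittagLeffler α (-(x ^ 2)) := by
    rw [← integral_comp_rpow_Ioi_of_pos (two_pos : (0:ℝ) < 2), ← integral_const_mul]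
    apply setIntegral_congr_fun measurableSet_Ioi
    intro x hx
    exact subst_aux α hx
  have h2 := integral_comp_abs (f := fun w => mittagLeffler α (-(z * w ^ 2)))
  simp only [sq_abs] at h2
  have h3 := integral_comp_mul_left_Ioi (fun x => mittagLeffler α (-(x ^ 2))) 0
    (b := z ^ ((1:ℝ)/2)) (by positivity)
  have hz2 : (z ^ ((1:ℝ)/2)) ^ 2 = z := by
    rw [← rpow_natCast, ← rpow_mul hz.le]; norm_num
  simp only [mul_pow, hz2, mul_zero, smul_eq_mul] at h3
  rw [h2, h3, h1, show -(1:ℝ)/2 = -(1/2) by ring, rpow_neg hz.le]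
  ring

lemma main_lim {s α : ℝ} (hs : 3 < s) (hα : 0 < α) (hα1 : α ≤ 1) :
    Tendsto (fun T : ℝ => ∫ w in (-(π * T))..(π * T), mittagLeffler α (-(T ^ 2 * lsFun s (w / T))))
      atTop (nhds (∫ w : ℝ, mittagLeffler α (-(zetaReal (s - 2) * w ^ 2)))) := by
  obtain ⟨C, hC, hb⟩ := ml_bound hα hα1
  have hE := ml_neg_continuous hα
  have hl := ls_continuous hs
  have e : ∀ᶠ T : ℝ in atTop, ∫ w, (Ioc (-(π * T)) (π * T)).indicator
      (fun w => mittagLeffler α (-(T ^ 2 * lsFun s (w / T)))) w =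
      ∫ w in (-(π * T))..(π * T), mittagLeffler α (-(T ^ 2 * lsFun s (w / T))) := by
    filter_upwards [eventually_gt_atTop 0] with T hT
    have : 0 < π * T := by positivity
    rw [intervalIntegral.integral_of_le (by linarith), integral_indicator measurableSet_Ioc]
  refine Tendsto.congr' e ?_
  refine tendsto_integral_filter_of_dominated_convergence
    (fun w => C * (1 + (2 / π * w) ^ 2)⁻¹) ?_ ?_ ?_ ?_
  · filter_upwards with T
    apply AEStronglyMeasurable.indicator _ measurableSet_Ioc
    exact (hE.comp (by fun_prop : Continuous fun w => T ^ 2 * lsFun s (w / T))).aestronglyMeasurable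
  · filter_upwards [eventually_gt_atTop 0] with T hT
    refine Filter.Eventually.of_forall fun w => ?_
    by_cases hw : w ∈ Ioc (-(π * T)) (π * T)
    · rw [indicator_of_mem hw]
      have hk : |w / T| ≤ π := by
        rw [abs_div, abs_of_pos hT, div_le_iff₀ hT]
        exact abs_le.2 ⟨hw.1.le, hw.2⟩
      have h1 := ls_lower hs hk
      have h2 : (2 / π * w) ^ 2 ≤ T ^ 2 * lsFun s (w / T) := by
        calc (2 / π * w) ^ 2 = T ^ 2 * (4 / π ^ 2 * (w / T) ^ 2) := by field_simp; norm_num; ring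
          _ ≤ _ := by gcongr
      refine (hb _ ((sq_nonneg _).trans h2)).trans ?_
      gcongr
    · rw [indicator_of_notMem hw, norm_zero]; positivity
  · exact ((integrable_inv_one_add_sq).comp_mul_left' (by positivity)).const_mul C
  · refine Filter.Eventually.of_forall fun w => ?_
    have h1 := ((hE.tendsto _).comp (ls_lim hs w))
    refine h1.congr' ?_
    filter_upwards [eventually_gt_atTop (|w|)] with T hT
    have hw : w ∈ Ioc (-(π * T)) (π * T) := by
      have := abs_lt.1 hT
      have h0 := (abs_nonneg w).trans_lt hT
      have : T ≤ π * T := by nlinarith [Real.pi_gt_three]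
      constructor <;> linarith
    rw [indicator_of_mem hw]
    rfl

/-- for `s > 3` and `0 < α ≤ 1`, the maximum of the fundamental
solution of the GDE on the infinite path graph decays as `t^{-α/2}`:
`t^{α/2} f_0(t) → (1/(2π)) ζ(s-2)^{-1/2} ∫_0^∞ u^{-1/2} E_α(-u) du`. -/
theorem GDE_max_decay_large_s
    (s α : ℝ) (hs : 3 < s) (hα : 0 < α) (hα1 : α ≤ 1) :
    IntegrableOn (fun u : ℝ => u ^ (-(1:ℝ)/2) * mittagLeffler α (-u)) (Ioi 0) ∧
    Tendsto
      (fun t : ℝ => t ^ (α / 2) *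
        ((1 / (2 * π)) * ∫ k in (-π)..π, mittagLeffler α (-(t ^ α) * lsFun s k)))
      atTop
      (nhds ((1 / (2 * π)) * zetaReal (s - 2) ^ (-(1:ℝ)/2) *
        ∫ u in Ioi (0:ℝ), u ^ (-(1:ℝ)/2) * mittagLeffler α (-u))) := by

  refine ⟨part1 hα hα1, ?_⟩
  have hT : Tendsto (fun t : ℝ => t ^ (α / 2)) atTop atTop := tendsto_rpow_atTop (by positivity)
  have h := ((main_lim hs hα hα1).comp hT).const_mul (1 / (2 * π))
  rw [part2 (zeta_pos hs), ← mul_assoc] at h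
  refine h.congr' ?_
  filter_upwards [eventually_gt_atTop 0] with t ht
  have hT0 : 0 < t ^ (α / 2) := by positivity
  have hsq : (t ^ (α / 2)) ^ 2 = t ^ α := by
    rw [← rpow_natCast, ← rpow_mul ht.le]; congr 1; push_cast; ring
  simp only [Function.comp_apply]
  have hi := intervalIntegral.integral_comp_div (a := -(π * t ^ (α / 2))) (b := π * t ^ (α / 2))
    (fun k => mittagLeffler α (-(t ^ α * lsFun s k))) hT0.ne'
  rw [hsq, hi, neg_div, mul_div_cancel_right₀ _ hT0.ne', smul_eq_mul]
  simp only [neg_mul]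
  ring
end

section
/- Let 0 < α ≤ 1, 1 < β ≤ 2 and c > 0, and for x ∈ ℝ and t > 0 define g(x,t) = ∫_{-∞}^{∞} e^{-i k x} E_α(-c t^α |k|^β) dk. Then the integral converges absolutely, and g satisfies the exact self-similarity relation g(t^{α/β} · x, t) = t^{-α/β} · g(x, 1) for every x ∈ ℝ and t > 0. In particular, the full width at half maximum of the profile x ↦ g(x,t) grows proportionally to t^{α/β}. -/
open Real MeasureTheory

/-- `g(x,t) = ∫_{-∞}^{∞} e^{-ikx} E_α(-c tᵅ |k|^β) dk`. -/
noncomputable def gProfile (α β c : ℝ) (x t : ℝ) : ℂ :=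
  ∫ k : ℝ, Complex.exp (-Complex.I * k * x) *
    ((mittagLeffler α (-c * t ^ α * |k| ^ β) : ℝ) : ℂ)

noncomputable def pc (a : ℝ) : ℕ → ℝ
  | 0 => 1
  | n + 1 => pc a n * (a + n) / (n + 1)

lemma pc_zero (a : ℝ) : pc a 0 = 1 := rfl

lemma pc_succ (a : ℝ) (n : ℕ) : ((n : ℝ) + 1) * pc a (n + 1) = (a + n) * pc a n := by
  have : (n : ℝ) + 1 ≠ 0 := by positivity
  rw [pc]; field_simp

lemma pc_nonneg {a : ℝ} (ha : 0 ≤ a) (n : ℕ) : 0 ≤ pc a n := by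
  induction n with
  | zero => simp [pc]
  | succ n ih => rw [pc]; positivity

lemma pc_one (n : ℕ) : pc 1 n = 1 := by
  induction n with
  | zero => rfl
  | succ n ih => rw [pc, ih]; field_simp; ring

lemma pc_zero_succ (n : ℕ) : pc 0 (n + 1) = 0 := by
  induction n with
  | zero => simp [pc]
  | succ n ih => rw [pc, ih]; simp

lemma pc_neg_succ {α : ℝ} (hα : 0 ≤ α) (hα1 : α ≤ 1) (n : ℕ) : pc (-α) (n + 1) ≤ 0 := by
  induction n with
  | zero => simp [pc, hα]
  | succ n ih =>
    rw [pc]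
    apply div_nonpos_of_nonpos_of_nonneg _ (by positivity)
    apply mul_nonpos_of_nonpos_of_nonneg ih
    push_cast
    have : (0 : ℝ) ≤ n := by positivity
    linarith

lemma pc_conv (a b : ℝ) (n : ℕ) :
    ∑ p ∈ Finset.HasAntidiagonal.antidiagonal n, pc a p.1 * pc b p.2 = pc (a + b) n := by
  induction n with
  | zero => simp [pc]
  | succ n ih =>
    have h0 : (n : ℝ) + 1 ≠ 0 := by positivity
    apply mul_left_cancel₀ h0
    rw [pc_succ, ← ih, Finset.mul_sum]
    have e1 : ∑ p ∈ Finset.HasAntidiagonal.antidiagonal (n + 1), ((n : ℝ) + 1) * (pc a p.1 * pc b p.2)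
        = ∑ p ∈ Finset.HasAntidiagonal.antidiagonal (n + 1), ((p.1 : ℝ) * pc a p.1) * pc b p.2
        + ∑ p ∈ Finset.HasAntidiagonal.antidiagonal (n + 1), pc a p.1 * ((p.2 : ℝ) * pc b p.2) := by
      rw [← Finset.sum_add_distrib]
      apply Finset.sum_congr rfl
      intro p hp
      have := Finset.HasAntidiagonal.mem_antidiagonal.1 hp
      have h : (p.1 : ℝ) + p.2 = n + 1 := by exact_mod_cast this
      rw [← h]; ring
    rw [e1, Finset.Nat.sum_antidiagonal_succ, Finset.Nat.sum_antidiagonal_succ', Finset.mul_sum]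
    simp only [Nat.cast_zero, zero_mul, mul_zero, zero_add, add_zero, Nat.cast_succ, pc_succ]
    rw [← Finset.sum_add_distrib]
    apply Finset.sum_congr rfl
    intro p hp
    have := Finset.HasAntidiagonal.mem_antidiagonal.1 hp
    have h : (p.1 : ℝ) + p.2 = n := by exact_mod_cast this
    rw [← h]; ring

noncomputable def DD (a : ℝ) : PowerSeries ℝ := PowerSeries.mk (pc a)

lemma DD_mul (a b : ℝ) : DD a * DD b = DD (a + b) := by
  ext n
  simp [DD, PowerSeries.coeff_mul, pc_conv]

lemma DD_zero : DD 0 = 1 := by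
  ext n
  cases n with
  | zero => simp [DD, pc]
  | succ n => simp [DD, pc_zero_succ, PowerSeries.coeff_one]

/-- positivity propagation -/
lemma pos_prop {α μ : ℝ} (hα : 0 ≤ α) (hα1 : α ≤ 1) (hμ : 0 < μ) (F R : PowerSeries ℝ)
    (h : (DD (-α) + PowerSeries.C μ) * F = R) (hR : ∀ n, 0 ≤ PowerSeries.coeff n R) (n : ℕ) :
    0 ≤ PowerSeries.coeff n F := by
  induction n using Nat.strong_induction_on with
  | _ n ih =>
    have h1 := congrArg (PowerSeries.coeff n) h
    rw [add_mul, map_add, PowerSeries.coeff_C_mul, PowerSeries.coeff_mul] at h1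
    have h2 := hR n
    rw [← h1] at h2
    cases n with
    | zero =>
      simp only [Finset.Nat.antidiagonal_zero, Finset.sum_singleton, DD, PowerSeries.coeff_mk, pc_zero]
        at h2
      nlinarith
    | succ n =>
      rw [Finset.Nat.sum_antidiagonal_succ] at h2
      simp only [DD, PowerSeries.coeff_mk, pc_zero] at h2
      have h3 : ∑ p ∈ Finset.HasAntidiagonal.antidiagonal n, pc (-α) (p.1 + 1) * PowerSeries.coeff p.2 F ≤ 0 := by
        apply Finset.sum_nonpos
        intro p hp
        have := Finset.HasAntidiagonal.mem_antidiagonal.1 hp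
        exact mul_nonpos_of_nonpos_of_nonneg (pc_neg_succ hα hα1 _) (ih _ (by omega))
      nlinarith

lemma volterra {α μ : ℝ} (hα : 0 ≤ α) (hα1 : α ≤ 1) (hμ : 0 < μ) (F : PowerSeries ℝ)
    (h : F + PowerSeries.C μ * (DD α * F) = DD 1) (n : ℕ) :
    0 ≤ PowerSeries.coeff n F ∧ PowerSeries.coeff n F * (1 + μ * pc (α + 1) n) ≤ 1 := by
  have hinv : DD (-α) * DD α = 1 := by rw [DD_mul, neg_add_cancel, DD_zero]
  have hF : (DD (-α) + PowerSeries.C μ) * F = DD (1 - α) := by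
    have : DD (-α) * (F + PowerSeries.C μ * (DD α * F)) = DD (1 - α) := by
      rw [h, DD_mul]; congr 1; ring
    rw [← this]
    linear_combination (-PowerSeries.C μ * F) * hinv
  have hpos : ∀ n, 0 ≤ PowerSeries.coeff n F := by
    apply pos_prop hα hα1 hμ F _ hF
    intro n
    simpa [DD] using pc_nonneg (by linarith) n
  have hH : (DD (-α) + PowerSeries.C μ) * (1 - DD (-1) * F) = PowerSeries.C μ := by
    have h1 : DD (-1) * DD (1 - α) = DD (-α) := by rw [DD_mul]; congr 1; ring
    linear_combination (-DD (-1)) * hF - h1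
  have hHpos := pos_prop hα hα1 hμ _ _ hH (by
    intro n; rw [PowerSeries.coeff_C]; split_ifs <;> linarith)
  have hG : F = DD 1 * (DD (-1) * F) := by
    rw [← mul_assoc, DD_mul, add_neg_cancel, DD_zero, one_mul]
  have hanti : Antitone (fun n => PowerSeries.coeff n F) := by
    apply antitone_nat_of_succ_le
    intro n
    have hh := hHpos (n + 1)
    have hc : PowerSeries.coeff (n + 1) (DD (-1) * F)
        = PowerSeries.coeff (n + 1) F - PowerSeries.coeff n F := by
      have e : DD (-1) = 1 - PowerSeries.X := by
        ext m
        rcases m with _ | _ | m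
        · simp [DD, pc]
        · simp [DD, pc, PowerSeries.coeff_one]
        · have : ∀ m, pc (-1) (m + 2) = 0 := by
            intro m
            induction m with
            | zero => simp [pc]
            | succ m ih => rw [pc, ih]; simp
          simp [DD, this, PowerSeries.coeff_one, PowerSeries.coeff_X]
      rw [e, sub_mul, one_mul, map_sub, PowerSeries.coeff_succ_X_mul]
    rw [map_sub, hc, PowerSeries.coeff_one] at hh
    simp at hh
    simpa using hh
  refine ⟨hpos n, ?_⟩
  have h1 := congrArg (PowerSeries.coeff n) h
  rw [map_add, PowerSeries.coeff_C_mul, PowerSeries.coeff_mul] at h1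
  simp only [DD, PowerSeries.coeff_mk, pc_one] at h1
  have h2 : PowerSeries.coeff n F * pc (α + 1) n ≤
      ∑ p ∈ Finset.HasAntidiagonal.antidiagonal n, pc α p.1 * PowerSeries.coeff p.2 F := by
    rw [← pc_conv, Finset.mul_sum]
    apply Finset.sum_le_sum
    intro p hp
    have := Finset.HasAntidiagonal.mem_antidiagonal.1 hp
    rw [pc_one, mul_one, mul_comm]
    exact mul_le_mul_of_nonneg_left (hanti (by omega)) (pc_nonneg hα _)
  nlinarith

lemma pc_le (s : ℝ) (hs : 0 ≤ s) (n : ℕ) : pc (s + 1) n ≤ (1 + s) ^ n := by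
  induction n with
  | zero => simp [pc]
  | succ n ih =>
    rw [pc, pow_succ, mul_div_assoc]
    apply mul_le_mul ih _ (by positivity) (by positivity)
    rw [div_le_iff₀ (by positivity)]
    have : (0 : ℝ) ≤ s * n := by positivity
    nlinarith

lemma summ_pc {α μ : ℝ} (hα : 0 ≤ α) (hα1 : α ≤ 1) (hμ : 0 ≤ μ) (hμ1 : μ < 1) (n : ℕ) :
    Summable (fun j : ℕ => μ ^ j * pc (α * j + 1) n) := by
  rcases hμ.eq_or_lt with rfl | hμ0
  · apply summable_of_ne_finset_zero (s := {0})
    intro j hj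
    simp at hj
    simp [hj]
  have h := summable_pow_mul_geometric_of_norm_lt_one (R := ℝ) n
    (r := μ) (by rwa [Real.norm_of_nonneg hμ])
  have h2 := (summable_nat_add_iff 1).2 h
  have h3 := h2.mul_left μ⁻¹
  refine Summable.of_nonneg_of_le (fun j => ?_) (fun j => ?_) h3
  · exact mul_nonneg (by positivity) (pc_nonneg (by positivity) n)
  · have e : μ⁻¹ * ((((j + 1 : ℕ) : ℝ)) ^ n * μ ^ (j + 1)) = μ ^ j * (1 + (j : ℝ)) ^ n := by
      push_cast; rw [pow_succ μ]; field_simp; ring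
    rw [e]
    apply mul_le_mul_of_nonneg_left _ (by positivity)
    refine (pc_le _ (by positivity) n).trans ?_
    gcongr
    have : (0 : ℝ) ≤ j := by positivity
    nlinarith

noncomputable def ff (α μ : ℝ) (n : ℕ) : ℝ := ∑' j : ℕ, (-μ) ^ j * pc (α * j + 1) n

lemma summ_ff {α μ : ℝ} (hα : 0 ≤ α) (hα1 : α ≤ 1) (hμ : 0 ≤ μ) (hμ1 : μ < 1) (n : ℕ) :
    Summable (fun j : ℕ => (-μ) ^ j * pc (α * j + 1) n) := by
  apply Summable.of_norm
  convert summ_pc hα hα1 hμ hμ1 n using 2 with j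
  rw [norm_mul, norm_pow, norm_neg, Real.norm_of_nonneg hμ,
    Real.norm_of_nonneg (pc_nonneg (by positivity) n)]

lemma ff_eq {α μ : ℝ} (hα : 0 ≤ α) (hα1 : α ≤ 1) (hμ : 0 ≤ μ) (hμ1 : μ < 1) :
    PowerSeries.mk (ff α μ) + PowerSeries.C μ * (DD α * PowerSeries.mk (ff α μ)) = DD 1 := by
  ext n
  rw [map_add, PowerSeries.coeff_C_mul, PowerSeries.coeff_mul]
  simp only [DD, PowerSeries.coeff_mk]
  have h1 : ∑ p ∈ Finset.HasAntidiagonal.antidiagonal n, pc α p.1 * ff α μ p.2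
      = ∑' j : ℕ, (-μ) ^ j * pc (α * (j + 1 : ℕ) + 1) n := by
    unfold ff
    simp_rw [← tsum_mul_left]
    rw [← Summable.tsum_finsetSum]
    · apply tsum_congr
      intro j
      have : α * ((j + 1 : ℕ) : ℝ) + 1 = α + (α * j + 1) := by push_cast; ring
      rw [this, ← pc_conv, Finset.mul_sum]
      apply Finset.sum_congr rfl
      intro p _; ring
    · intro p _
      exact (summ_ff hα hα1 hμ hμ1 p.2).mul_left _
  rw [h1, ff, (summ_ff hα hα1 hμ hμ1 n).tsum_eq_zero_add, ← tsum_mul_left, add_assoc, ← Summable.tsum_add]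
  · simp only [pow_succ]
    have : ∀ b : ℕ, (-μ) ^ b * -μ * pc (α * ((b + 1 : ℕ) : ℝ) + 1) n
      + μ * ((-μ) ^ b * pc (α * ((b + 1 : ℕ) : ℝ) + 1) n) = 0 := by intro b; ring
    simp only [this, tsum_zero, add_zero]
    simp [pc_one]
  · exact (summable_nat_add_iff 1).2 (summ_ff hα hα1 hμ hμ1 n)
  · have := ((summable_nat_add_iff 1).2 (summ_ff hα hα1 hμ hμ1 n)).neg
    convert this using 2 with b
    rw [pow_succ]; ring

noncomputable def BB (s : ℝ) (n : ℕ) : ℝ := pc (s + 1) n / (n : ℝ) ^ s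

lemma BB_nonneg {s : ℝ} (hs : 0 ≤ s) (n : ℕ) : 0 ≤ BB s n :=
  div_nonneg (pc_nonneg (by positivity) n) (by positivity)

lemma pc_prod (s : ℝ) (n : ℕ) :
    pc (s + 1) n * n.factorial = ∏ j ∈ Finset.range n, (s + ((j + 1 : ℕ) : ℝ)) := by
  induction n with
  | zero => simp [pc]
  | succ n ih =>
    rw [Finset.prod_range_succ, ← ih, pc, Nat.factorial_succ]
    push_cast; field_simp; ring

lemma BB_tendsto {s : ℝ} (hs : 0 ≤ s) :
    Filter.Tendsto (BB s) Filter.atTop (nhds (1 / Real.Gamma (s + 1))) := by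
  rcases hs.eq_or_lt with rfl | hs0
  · have : BB 0 = fun _ => 1 := by
      funext n; simp [BB, pc_one]
    rw [this]; simp
  have h := Real.GammaSeq_tendsto_Gamma s
  have h2 := (h.const_mul s).inv₀ (by have := Real.Gamma_pos_of_pos hs0; positivity)
  rw [Real.Gamma_add_one hs0.ne', one_div]
  refine h2.congr' ?_
  filter_upwards [Filter.eventually_gt_atTop 0] with n hn
  rw [Real.GammaSeq, Finset.prod_range_succ', ← pc_prod, BB]
  have h3 : (0 : ℝ) < (n : ℝ) ^ s := by positivity
  have h4 : (0 : ℝ) < n.factorial := by positivity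
  simp only [Nat.cast_zero, add_zero]
  field_simp

lemma BB_succ_le {s : ℝ} (hs : 0 ≤ s) (n : ℕ) (hn : 0 < n) : BB s (n + 1) ≤ BB s n := by
  have hn' : (0 : ℝ) < n := by exact_mod_cast hn
  rw [BB, BB, div_le_div_iff₀ (by positivity) (by positivity), pc, mul_div_assoc, mul_assoc]
  apply mul_le_mul_of_nonneg_left _ (pc_nonneg (by positivity) n)
  have e : ((n + 1 : ℕ) : ℝ) = n * (1 + 1 / n) := by push_cast; field_simp
  rw [e, Real.mul_rpow (by positivity) (by positivity), mul_comm]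
  apply mul_le_mul_of_nonneg_left _ (by positivity)
  have hl : 1 / ((n : ℝ) + 1) ≤ Real.log (1 + 1 / n) := by
    have := Real.one_sub_inv_le_log_of_pos (x := 1 + 1 / (n : ℝ)) (by positivity)
    refine le_trans (le_of_eq ?_) this
    field_simp; ring
  rw [Real.rpow_def_of_pos (by positivity)]
  refine le_trans ?_ (Real.add_one_le_exp _)
  have : (s + 1 + n) / ((n : ℝ) + 1) = 1 / (n + 1) * s + 1 := by field_simp; ring
  rw [this]
  gcongr

lemma BB_anti {s : ℝ} (hs : 0 ≤ s) {N n : ℕ} (hN : 0 < N) (h : N ≤ n) : BB s n ≤ BB s N := by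
  induction n, h using Nat.le_induction with
  | base => rfl
  | succ n h ih => exact (BB_succ_le hs n (by omega)).trans ih

lemma BB_rel {α : ℝ} (x : ℝ) (n j : ℕ) :
    x ^ j * BB (α * j) n = (x * (n : ℝ) ^ (-α)) ^ j * pc (α * j + 1) n := by
  rw [BB, mul_pow, ← Real.rpow_mul_natCast (by positivity), neg_mul, Real.rpow_neg (by positivity)]
  ring

lemma exists_N {α : ℝ} (hα : 0 < α) (y : ℝ) : ∃ N : ℕ, 0 < N ∧ ∀ n ≥ N, y * (n : ℝ) ^ (-α) < 1 := by
  have h := ((tendsto_rpow_neg_atTop hα).comp tendsto_natCast_atTop_atTop).const_mul y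
  rw [mul_zero] at h
  obtain ⟨N, hN⟩ := Filter.eventually_atTop.1 (h.eventually_lt_const one_pos)
  exact ⟨N + 1, by omega, fun n hn => hN n (by omega)⟩

lemma summ_BB {α : ℝ} (hα : 0 < α) (hα1 : α ≤ 1) {y : ℝ} (hy : 0 ≤ y) {N : ℕ}
    (hN : y * (N : ℝ) ^ (-α) < 1) : Summable (fun j : ℕ => y ^ j * BB (α * j) N) := by
  simp_rw [BB_rel]
  exact summ_pc hα.le hα1 (by positivity) hN N

lemma summ_ML {α : ℝ} (hα : 0 < α) (hα1 : α ≤ 1) (x : ℝ) :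
    Summable (fun j : ℕ => x ^ j / Real.Gamma (α * j + 1)) := by
  obtain ⟨N, hN0, hN⟩ := exists_N hα |x|
  refine Summable.of_norm_bounded (summ_BB hα hα1 (abs_nonneg x) (hN N le_rfl)) ?_
  intro j
  have hG : 0 < Real.Gamma (α * j + 1) := Real.Gamma_pos_of_pos (by positivity)
  rw [norm_div, norm_pow, Real.norm_eq_abs, Real.norm_of_nonneg hG.le, div_eq_mul_one_div]
  gcongr
  refine le_of_tendsto (BB_tendsto (s := α * j) (by positivity)) ?_
  filter_upwards [Filter.eventually_ge_atTop N] with n hn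
  exact BB_anti (by positivity) hN0 hn

lemma ML_bound {α : ℝ} (hα : 0 < α) (hα1 : α ≤ 1) {y : ℝ} (hy : 0 < y) :
    0 ≤ mittagLeffler α (-y) ∧ mittagLeffler α (-y) * (1 + y / Real.Gamma (α + 1)) ≤ 1 := by
  obtain ⟨N, hN0, hN⟩ := exists_N hα y
  have hlim : Filter.Tendsto (fun n : ℕ => ∑' j : ℕ, (-y) ^ j * BB (α * j) n) Filter.atTop
      (nhds (mittagLeffler α (-y))) := by
    unfold mittagLeffler
    refine tendsto_tsum_of_dominated_convergence (summ_BB hα hα1 hy.le (hN N le_rfl)) ?_ ?_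
    · intro j
      rw [div_eq_mul_one_div]
      exact (BB_tendsto (by positivity)).const_mul _
    · filter_upwards [Filter.eventually_ge_atTop N] with n hn j
      rw [norm_mul, norm_pow, norm_neg, Real.norm_of_nonneg hy.le,
        Real.norm_of_nonneg (BB_nonneg (by positivity) n)]
      gcongr
      exact BB_anti (by positivity) hN0 hn
  have key : ∀ n ≥ N, 0 ≤ (∑' j : ℕ, (-y) ^ j * BB (α * j) n) ∧
      (∑' j : ℕ, (-y) ^ j * BB (α * j) n) * (1 + y * BB α n) ≤ 1 := by
    intro n hn
    have hn0 : (0 : ℝ) < n := by exact_mod_cast (by omega : 0 < n)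
    have e : (∑' j : ℕ, (-y) ^ j * BB (α * j) n) = ff α (y * (n : ℝ) ^ (-α)) n := by
      simp_rw [BB_rel, ff, neg_mul]
    have e2 : y * BB α n = y * (n : ℝ) ^ (-α) * pc (α + 1) n := by
      have := BB_rel (α := α) y n 1
      simpa using this
    have := volterra hα.le hα1 (μ := y * (n : ℝ) ^ (-α)) (by positivity) _
      (ff_eq hα.le hα1 (by positivity) (hN n hn)) n
    rw [PowerSeries.coeff_mk] at this
    rwa [e, e2]
  constructor
  · exact ge_of_tendsto hlim (Filter.eventually_atTop.2 ⟨N, fun n hn => (key n hn).1⟩)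
  · have h2 := hlim.mul (((BB_tendsto hα.le).const_mul y).const_add 1)
    rw [← div_eq_mul_one_div] at h2
    exact le_of_tendsto h2 (Filter.eventually_atTop.2 ⟨N, fun n hn => (key n hn).2⟩)

lemma ML_zero (α : ℝ) : mittagLeffler α 0 = 1 := by
  unfold mittagLeffler
  rw [tsum_eq_single 0]
  · simp
  · intro j hj; simp [hj]

lemma ML_meas {α : ℝ} (hα : 0 < α) (hα1 : α ≤ 1) : Measurable (mittagLeffler α) := by
  refine measurable_of_tendsto_metrizable
    (f := fun n x => ∑ j ∈ Finset.range n, x ^ j / Real.Gamma (α * j + 1)) ?_ ?_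
  · intro n; fun_prop
  · rw [tendsto_pi_nhds]
    intro x
    exact (summ_ML hα hα1 x).hasSum.tendsto_sum_nat

lemma ML_le {α : ℝ} (hα : 0 < α) (hα1 : α ≤ 1) : ∃ C : ℝ, 0 < C ∧ ∀ y : ℝ, 0 ≤ y →
    |mittagLeffler α (-y)| ≤ 1 / (1 + y / C) := by
  have hG : 0 < Real.Gamma (α + 1) := Real.Gamma_pos_of_pos (by positivity)
  refine ⟨_, hG, fun y hy => ?_⟩
  rcases hy.eq_or_lt with rfl | hy
  · simp [ML_zero]
  · obtain ⟨h1, h2⟩ := ML_bound hα hα1 hy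
    rw [abs_of_nonneg h1, le_div_iff₀ (by positivity)]
    exact h2

lemma ML_integrable {α β A : ℝ} (hα : 0 < α) (hα1 : α ≤ 1) (hβ1 : 1 < β) (hA : 0 < A) :
    Integrable (fun k : ℝ => mittagLeffler α (-(A * |k| ^ β))) := by
  obtain ⟨C, hC, h⟩ := ML_le hα hα1
  have hI : Integrable (fun k : ℝ => (1 + ‖k‖) ^ (-β)) :=
    integrable_one_add_norm (by simpa using hβ1)
  set m := min 1 (A / C) with hm
  have hm0 : 0 < m := lt_min one_pos (by positivity)
  refine (hI.const_mul (m⁻¹ * 2 ^ (β - 1))).mono' ?_ ?_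
  · apply Measurable.aestronglyMeasurable
    apply (ML_meas hα hα1).comp
    fun_prop
  · refine Filter.Eventually.of_forall fun k => ?_
    refine (h _ (by positivity)).trans ?_
    rw [Real.rpow_neg (by positivity), Real.norm_eq_abs, div_le_iff₀ (by positivity)]
    have h1 : (1 + |k|) ^ β ≤ 2 ^ (β - 1) * (1 + |k| ^ β) := by
      have := NNReal.rpow_add_le_mul_rpow_add_rpow 1 (Real.nnabs k) hβ1.le
      have h' := NNReal.coe_le_coe.2 this
      push_cast at h'
      simpa using h'
    have h2 : m * (1 + |k| ^ β) ≤ 1 + A * |k| ^ β / C := by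
      have hk : 0 ≤ |k| ^ β := by positivity
      have a1 : m ≤ 1 := min_le_left _ _
      have a2 : m * |k| ^ β ≤ A / C * |k| ^ β := mul_le_mul_of_nonneg_right (min_le_right _ _) hk
      have : A * |k| ^ β / C = A / C * |k| ^ β := by ring
      linarith
    have hp : 0 < (1 + |k|) ^ β := by positivity
    rw [show m⁻¹ * 2 ^ (β - 1) * ((1 + |k|) ^ β)⁻¹ * (1 + A * |k| ^ β / C)
      = 2 ^ (β - 1) * (1 + A * |k| ^ β / C) / (m * (1 + |k|) ^ β) by field_simp]
    rw [le_div_iff₀ (by positivity), one_mul]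
    calc m * (1 + |k|) ^ β ≤ m * (2 ^ (β - 1) * (1 + |k| ^ β)) := by gcongr
      _ = 2 ^ (β - 1) * (m * (1 + |k| ^ β)) := by ring
      _ ≤ _ := by gcongr

/-- the continuum profile is absolutely integrable and exactly
self-similar: `g(t^{α/β} x, t) = t^{-α/β} g(x, 1)`; in particular its FWHM grows
as `t^{α/β}`. -/
theorem gProfile_self_similar
    (α β c : ℝ) (hα : 0 < α) (hα1 : α ≤ 1) (hβ1 : 1 < β) (hβ2 : β ≤ 2) (hc : 0 < c)
    (x t : ℝ) (ht : 0 < t) :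
    Integrable (fun k : ℝ => Complex.exp (-Complex.I * k * x) *
      ((mittagLeffler α (-c * t ^ α * |k| ^ β) : ℝ) : ℂ)) ∧
    gProfile α β c (t ^ (α / β) * x) t = ((t ^ (-(α / β)) : ℝ) : ℂ) * gProfile α β c x 1 := by
  constructor
  · have h := (ML_integrable (α := α) (β := β) (A := c * t ^ α) hα hα1 hβ1 (by positivity)).ofReal (𝕜 := ℂ)
    have h' : Integrable (fun k : ℝ => ((mittagLeffler α (-c * t ^ α * |k| ^ β) : ℝ) : ℂ)) := by
      have e : ∀ k : ℝ, -c * t ^ α * |k| ^ β = -(c * t ^ α * |k| ^ β) := fun k => by ring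
      simp_rw [e]
      exact h
    refine h'.bdd_mul (c := 1) (by fun_prop) ?_
    refine Filter.Eventually.of_forall fun k => ?_
    rw [Complex.norm_exp]
    simp
  · have ha : 0 < t ^ (α / β) := by positivity
    have hab : (t ^ (α / β)) ^ β = t ^ α := by
      rw [← Real.rpow_mul ht.le, div_mul_cancel₀ _ (by linarith)]
    have h := Measure.integral_comp_mul_left (fun k : ℝ => Complex.exp (-Complex.I * k * x) *
      ((mittagLeffler α (-c * 1 ^ α * |k| ^ β) : ℝ) : ℂ)) (t ^ (α / β))
    rw [abs_of_pos (by positivity), ← Real.rpow_neg ht.le, Complex.real_smul] at h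
    unfold gProfile
    rw [← h]
    congr 1
    funext k
    rw [abs_mul, abs_of_pos ha, Real.mul_rpow ha.le (abs_nonneg k), hab, Real.one_rpow]
    congr 2
    · push_cast; ring
    · congr 1; ring
end
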